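/- arXiv:2508.09405 — 2 statements merged into one kernel-verified Lean document; each statement's English description precedes it below -/
import Mathlib

section
/- The classes [M] and [M'] are central elements of the Hall algebra Hall(Q_Rud) of the category of finite-dimensional representations of the Rudakov quiver over F_q. -/
open scoped Classical
set_option maxHeartbeats 1000000

noncomputable section

/-- A finite-dimensional representation of the Rudakov quiver `Q_Rud` over a field `k`:
two finite-dimensional vector spaces `V₁`, `V₂`, maps `e f : V₁ → V₂` and
`e' f' : V₂ → V₁` satisfying `ee' = e'e = ff' = f'f = 0`, `ef' = -fe'`, `e'f = -f'e`. -/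
structure RudRep (k : Type) [Field k] : Type 1 where
  V₁ : Type
  V₂ : Type
  [acg₁ : AddCommGroup V₁]
  [acg₂ : AddCommGroup V₂]
  [mod₁ : Module k V₁]
  [mod₂ : Module k V₂]
  [fd₁ : FiniteDimensional k V₁]
  [fd₂ : FiniteDimensional k V₂]
  e : V₁ →ₗ[k] V₂
  f : V₁ →ₗ[k] V₂
  e' : V₂ →ₗ[k] V₁
  f' : V₂ →ₗ[k] V₁
  rel_ee' : e ∘ₗ e' = 0
  rel_e'e : e' ∘ₗ e = 0
  rel_ff' : f ∘ₗ f' = 0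
  rel_f'f : f' ∘ₗ f = 0
  rel_ef' : e ∘ₗ f' = -(f ∘ₗ e')
  rel_e'f : e' ∘ₗ f = -(f' ∘ₗ e)

attribute [instance] RudRep.acg₁ RudRep.acg₂ RudRep.mod₁ RudRep.mod₂ RudRep.fd₁ RudRep.fd₂

variable {k : Type} [Field k]

namespace RudRep

lemma ee'_apply (X : RudRep k) (y : X.V₂) : X.e (X.e' y) = 0 := by
  simpa using DFunLike.congr_fun X.rel_ee' y
lemma e'e_apply (X : RudRep k) (x : X.V₁) : X.e' (X.e x) = 0 := by
  simpa using DFunLike.congr_fun X.rel_e'e x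
lemma ff'_apply (X : RudRep k) (y : X.V₂) : X.f (X.f' y) = 0 := by
  simpa using DFunLike.congr_fun X.rel_ff' y
lemma f'f_apply (X : RudRep k) (x : X.V₁) : X.f' (X.f x) = 0 := by
  simpa using DFunLike.congr_fun X.rel_f'f x
lemma ef'_apply (X : RudRep k) (y : X.V₂) : X.e (X.f' y) = -(X.f (X.e' y)) := by
  simpa using DFunLike.congr_fun X.rel_ef' y
lemma e'f_apply (X : RudRep k) (x : X.V₁) : X.e' (X.f x) = -(X.f' (X.e x)) := by
  simpa using DFunLike.congr_fun X.rel_e'f x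

/-- The involution `σ` swapping the two vertices and interchanging `e ↔ e'`, `f ↔ f'`. -/
def sigma (X : RudRep k) : RudRep k where
  V₁ := X.V₂
  V₂ := X.V₁
  e := X.e'
  f := X.f'
  e' := X.e
  f' := X.f
  rel_ee' := X.rel_e'e
  rel_e'e := X.rel_ee'
  rel_ff' := X.rel_f'f
  rel_f'f := X.rel_ff'
  rel_ef' := X.rel_e'f
  rel_e'f := X.rel_ef'

/-- A representation is zero iff both underlying spaces are trivial. -/
def IsZero (X : RudRep k) : Prop := Subsingleton X.V₁ ∧ Subsingleton X.V₂

/-- Direct sum of two representations of the Rudakov quiver. -/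
def dsum (X Y : RudRep k) : RudRep k where
  V₁ := X.V₁ × Y.V₁
  V₂ := X.V₂ × Y.V₂
  e := X.e.prodMap Y.e
  f := X.f.prodMap Y.f
  e' := X.e'.prodMap Y.e'
  f' := X.f'.prodMap Y.f'
  rel_ee' := by
    apply LinearMap.ext; rintro ⟨a, b⟩
    simp [Prod.ext_iff, ee'_apply]
  rel_e'e := by
    apply LinearMap.ext; rintro ⟨a, b⟩
    simp [Prod.ext_iff, e'e_apply]
  rel_ff' := by
    apply LinearMap.ext; rintro ⟨a, b⟩
    simp [Prod.ext_iff, ff'_apply]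
  rel_f'f := by
    apply LinearMap.ext; rintro ⟨a, b⟩
    simp [Prod.ext_iff, f'f_apply]
  rel_ef' := by
    apply LinearMap.ext; rintro ⟨a, b⟩
    simp [Prod.ext_iff, ef'_apply]
  rel_e'f := by
    apply LinearMap.ext; rintro ⟨a, b⟩
    simp [Prod.ext_iff, e'f_apply]

/-- The zero representation. -/
def zeroRep (k : Type) [Field k] : RudRep k where
  V₁ := Fin 0 → k
  V₂ := Fin 0 → k
  e := 0
  f := 0
  e' := 0
  f' := 0
  rel_ee' := by simp
  rel_e'e := by simp
  rel_ff' := by simp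
  rel_f'f := by simp
  rel_ef' := by simp
  rel_e'f := by simp

/-- `n`-fold direct sum `X^{⊕ n}`. -/
def npow (X : RudRep k) : ℕ → RudRep k
  | 0 => zeroRep k
  | n + 1 => (npow X n).dsum X

end RudRep

/-- Morphisms of representations of `Q_Rud`, as a submodule of the product of Hom spaces:
pairs of linear maps commuting with `e, f, e', f'`. -/
def RudHomS (X Y : RudRep k) :
    Submodule k ((X.V₁ →ₗ[k] Y.V₁) × (X.V₂ →ₗ[k] Y.V₂)) where
  carrier := {p | Y.e ∘ₗ p.1 = p.2 ∘ₗ X.e ∧ Y.f ∘ₗ p.1 = p.2 ∘ₗ X.f ∧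
      Y.e' ∘ₗ p.2 = p.1 ∘ₗ X.e' ∧ Y.f' ∘ₗ p.2 = p.1 ∘ₗ X.f'}
  add_mem' := by
    intro a b ha hb
    obtain ⟨ha1, ha2, ha3, ha4⟩ := ha
    obtain ⟨hb1, hb2, hb3, hb4⟩ := hb
    refine ⟨?_, ?_, ?_, ?_⟩ <;>
      simp only [Prod.fst_add, Prod.snd_add, LinearMap.add_comp, LinearMap.comp_add,
        ha1, ha2, ha3, ha4, hb1, hb2, hb3, hb4]
  zero_mem' := by
    refine ⟨?_, ?_, ?_, ?_⟩ <;> simp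
  smul_mem' := by
    intro c a ha
    obtain ⟨h1, h2, h3, h4⟩ := ha
    refine ⟨?_, ?_, ?_, ?_⟩ <;>
      simp only [Prod.smul_fst, Prod.smul_snd, LinearMap.smul_comp, LinearMap.comp_smul,
        h1, h2, h3, h4]

/-- The space of morphisms of representations `X → Y`. -/
abbrev RudHom (X Y : RudRep k) : Type := ↥(RudHomS X Y)

private lemma square_comp
    {A₁ A₂ B₁ B₂ C₁ C₂ : Type}
    [AddCommGroup A₁] [AddCommGroup A₂] [AddCommGroup B₁] [AddCommGroup B₂]
    [AddCommGroup C₁] [AddCommGroup C₂]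
    [Module k A₁] [Module k A₂] [Module k B₁] [Module k B₂] [Module k C₁] [Module k C₂]
    (u : A₁ →ₗ[k] A₂) (v : B₁ →ₗ[k] B₂) (w : C₁ →ₗ[k] C₂)
    (h₁ : A₁ →ₗ[k] B₁) (h₂ : A₂ →ₗ[k] B₂) (g₁ : B₁ →ₗ[k] C₁) (g₂ : B₂ →ₗ[k] C₂)
    (hh : v ∘ₗ h₁ = h₂ ∘ₗ u) (hg : w ∘ₗ g₁ = g₂ ∘ₗ v) :
    w ∘ₗ (g₁ ∘ₗ h₁) = (g₂ ∘ₗ h₂) ∘ₗ u := by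
  apply LinearMap.ext
  intro x
  have e1 := DFunLike.congr_fun hh x
  have e2 := DFunLike.congr_fun hg (h₁ x)
  simp only [LinearMap.comp_apply] at e1 e2 ⊢
  rw [e2, e1]

/-- Composition of morphisms of representations. -/
def RudHom.comp {X Y Z : RudRep k} (g : RudHom Y Z) (h : RudHom X Y) : RudHom X Z := by
  refine ⟨(g.1.1 ∘ₗ h.1.1, g.1.2 ∘ₗ h.1.2), ?_⟩
  obtain ⟨hg1, hg2, hg3, hg4⟩ := g.2
  obtain ⟨hh1, hh2, hh3, hh4⟩ := h.2
  exact ⟨square_comp X.e Y.e Z.e h.1.1 h.1.2 g.1.1 g.1.2 hh1 hg1,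
    square_comp X.f Y.f Z.f h.1.1 h.1.2 g.1.1 g.1.2 hh2 hg2,
    square_comp X.e' Y.e' Z.e' h.1.2 h.1.1 g.1.2 g.1.1 hh3 hg3,
    square_comp X.f' Y.f' Z.f' h.1.2 h.1.1 g.1.2 g.1.1 hh4 hg4⟩

/-- The identity morphism. -/
def RudHom.idHom (X : RudRep k) : RudHom X X :=
  ⟨(LinearMap.id, LinearMap.id), by refine ⟨?_, ?_, ?_, ?_⟩ <;> simp⟩

/-- Two representations are isomorphic iff there is a morphism between them whose
components are bijective. -/
def RudIso (X Y : RudRep k) : Prop :=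
  ∃ g : RudHom X Y, Function.Bijective g.1.1 ∧ Function.Bijective g.1.2

/-- A representation is indecomposable if it is nonzero and any decomposition as a direct
sum has a trivial summand. -/
def RudRep.Indec (X : RudRep k) : Prop :=
  ¬ X.IsZero ∧ ∀ Y Z : RudRep k, RudIso X (Y.dsum Z) → Y.IsZero ∨ Z.IsZero

namespace RudRep

/-- Build a representation of `Q_Rud` from a representation of the Kronecker quiver,
extending by zero (`e' = f' = 0`). -/
def ofKron {V W : Type} [AddCommGroup V] [AddCommGroup W] [Module k V] [Module k W]
    [FiniteDimensional k V] [FiniteDimensional k W] (e f : V →ₗ[k] W) : RudRep k where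
  V₁ := V
  V₂ := W
  e := e
  f := f
  e' := 0
  f' := 0
  rel_ee' := by simp
  rel_e'e := by simp
  rel_ff' := by simp
  rel_f'f := by simp
  rel_ef' := by simp
  rel_e'f := by simp

/-- Build a representation of `Q_Rud` from four matrices satisfying the relations. -/
def ofMatrices {m n : ℕ} (E F : Matrix (Fin n) (Fin m) k) (E' F' : Matrix (Fin m) (Fin n) k)
    (h1 : E * E' = 0) (h2 : E' * E = 0) (h3 : F * F' = 0) (h4 : F' * F = 0)
    (h5 : E * F' = -(F * E')) (h6 : E' * F = -(F' * E)) : RudRep k where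
  V₁ := Fin m → k
  V₂ := Fin n → k
  e := Matrix.toLin' E
  f := Matrix.toLin' F
  e' := Matrix.toLin' E'
  f' := Matrix.toLin' F'
  rel_ee' := by rw [← Matrix.toLin'_mul, h1]; simp
  rel_e'e := by rw [← Matrix.toLin'_mul, h2]; simp
  rel_ff' := by rw [← Matrix.toLin'_mul, h3]; simp
  rel_f'f := by rw [← Matrix.toLin'_mul, h4]; simp
  rel_ef' := by rw [← Matrix.toLin'_mul, ← Matrix.toLin'_mul, h5]; simp
  rel_e'f := by rw [← Matrix.toLin'_mul, ← Matrix.toLin'_mul, h6]; simp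

end RudRep

/-- The projective-injective representation `M`, with `e x₁ = y₁`, `f x₁ = y₂`,
`e' y₂ = x₂`, `f' y₁ = -x₂` on bases `x₁, x₂` of `M₁` and `y₁, y₂` of `M₂`. -/
def repM (k : Type) [Field k] : RudRep k :=
  RudRep.ofMatrices (k := k)
    !![(1 : k), 0; 0, 0] !![(0 : k), 0; 1, 0] !![(0 : k), 0; 0, 1] !![(0 : k), 0; -1, 0]
    (by ext i j; fin_cases i <;> fin_cases j <;>
      simp [Matrix.mul_apply, Fin.sum_univ_two])
    (by ext i j; fin_cases i <;> fin_cases j <;>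
      simp [Matrix.mul_apply, Fin.sum_univ_two])
    (by ext i j; fin_cases i <;> fin_cases j <;>
      simp [Matrix.mul_apply, Fin.sum_univ_two])
    (by ext i j; fin_cases i <;> fin_cases j <;>
      simp [Matrix.mul_apply, Fin.sum_univ_two])
    (by ext i j; fin_cases i <;> fin_cases j <;>
      simp [Matrix.mul_apply, Fin.sum_univ_two])
    (by ext i j; fin_cases i <;> fin_cases j <;>
      simp [Matrix.mul_apply, Fin.sum_univ_two])

/-- The projective-injective representation `M' = σ(M)`. -/
def repM' (k : Type) [Field k] : RudRep k := (repM k).sigma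

/-- A subrepresentation of a representation of `Q_Rud`: a pair of submodules preserved
by the four maps. -/
structure RudSub (X : RudRep k) : Type where
  S₁ : Submodule k X.V₁
  S₂ : Submodule k X.V₂
  he : ∀ x ∈ S₁, X.e x ∈ S₂
  hf : ∀ x ∈ S₁, X.f x ∈ S₂
  he' : ∀ y ∈ S₂, X.e' y ∈ S₁
  hf' : ∀ y ∈ S₂, X.f' y ∈ S₁

/-- The representation carried by a subrepresentation. -/
def RudSub.toRep {X : RudRep k} (S : RudSub X) : RudRep k where
  V₁ := ↥S.S₁
  V₂ := ↥S.S₂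
  e := X.e.restrict S.he
  f := X.f.restrict S.hf
  e' := X.e'.restrict S.he'
  f' := X.f'.restrict S.hf'
  rel_ee' := by
    apply LinearMap.ext; intro y; apply Subtype.ext
    simp [LinearMap.restrict_apply, RudRep.ee'_apply]
  rel_e'e := by
    apply LinearMap.ext; intro x; apply Subtype.ext
    simp [LinearMap.restrict_apply, RudRep.e'e_apply]
  rel_ff' := by
    apply LinearMap.ext; intro y; apply Subtype.ext
    simp [LinearMap.restrict_apply, RudRep.ff'_apply]
  rel_f'f := by
    apply LinearMap.ext; intro x; apply Subtype.ext
    simp [LinearMap.restrict_apply, RudRep.f'f_apply]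
  rel_ef' := by
    apply LinearMap.ext; intro y; apply Subtype.ext
    simp [LinearMap.restrict_apply, RudRep.ef'_apply]
  rel_e'f := by
    apply LinearMap.ext; intro x; apply Subtype.ext
    simp [LinearMap.restrict_apply, RudRep.e'f_apply]

/-- The quotient of a representation by a subrepresentation. -/
def RudSub.quotRep {X : RudRep k} (S : RudSub X) : RudRep k where
  V₁ := X.V₁ ⧸ S.S₁
  V₂ := X.V₂ ⧸ S.S₂
  e := Submodule.mapQ S.S₁ S.S₂ X.e (fun x hx => S.he x hx)
  f := Submodule.mapQ S.S₁ S.S₂ X.f (fun x hx => S.hf x hx)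
  e' := Submodule.mapQ S.S₂ S.S₁ X.e' (fun y hy => S.he' y hy)
  f' := Submodule.mapQ S.S₂ S.S₁ X.f' (fun y hy => S.hf' y hy)
  rel_ee' := by
    apply LinearMap.ext; intro y
    obtain ⟨a, rfl⟩ := Submodule.Quotient.mk_surjective _ y
    simp [Submodule.mapQ_apply, RudRep.ee'_apply]
  rel_e'e := by
    apply LinearMap.ext; intro x
    obtain ⟨a, rfl⟩ := Submodule.Quotient.mk_surjective _ x
    simp [Submodule.mapQ_apply, RudRep.e'e_apply]
  rel_ff' := by
    apply LinearMap.ext; intro y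
    obtain ⟨a, rfl⟩ := Submodule.Quotient.mk_surjective _ y
    simp [Submodule.mapQ_apply, RudRep.ff'_apply]
  rel_f'f := by
    apply LinearMap.ext; intro x
    obtain ⟨a, rfl⟩ := Submodule.Quotient.mk_surjective _ x
    simp [Submodule.mapQ_apply, RudRep.f'f_apply]
  rel_ef' := by
    apply LinearMap.ext; intro y
    obtain ⟨a, rfl⟩ := Submodule.Quotient.mk_surjective _ y
    simp [Submodule.mapQ_apply, RudRep.ef'_apply]
  rel_e'f := by
    apply LinearMap.ext; intro x
    obtain ⟨a, rfl⟩ := Submodule.Quotient.mk_surjective _ x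
    simp [Submodule.mapQ_apply, RudRep.e'f_apply]

/-- The Hall number `c^E_{A,B}`: the number of subrepresentations of `E` isomorphic to
`B` with quotient isomorphic to `A`. -/
def hallNum (A B E : RudRep k) : ℕ :=
  Nat.card {S : RudSub E // RudIso S.toRep B ∧ RudIso S.quotRep A}

/-- The number of automorphisms of a representation. -/
def rudAutCard (X : RudRep k) : ℕ :=
  Nat.card {g : RudHom X X // Function.Bijective g.1.1 ∧ Function.Bijective g.1.2}

/-- Isomorphism classes of representations of `Q_Rud`. -/
abbrev IsoCl (k : Type) [Field k] := Quot (RudIso (k := k))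

/-- Elements of the Hall algebra, as finitely-supported coefficient functions on
isomorphism classes (finite linear combinations of classes). -/
abbrev HallEl (k : Type) [Field k] := IsoCl k → ℂ

/-- The basis element `[X]` of the Hall algebra. -/
def clOf (X : RudRep k) : HallEl k := fun C => if Quot.mk _ X = C then 1 else 0

/-- Structure constants of the Hall algebra on isomorphism classes. -/
def hallC (A B C : IsoCl k) : ℂ := (hallNum (Quot.out A) (Quot.out B) (Quot.out C) : ℂ)

/-- The Hall product: `([A]·[B])` has coefficient `c^E_{A,B}` at `[E]`. -/
def hallMul (u v : HallEl k) : HallEl k :=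
  fun C => ∑ᶠ A : IsoCl k, ∑ᶠ B : IsoCl k, u A * v B * hallC A B C

/-- Powers in the Hall algebra (the empty product is the class of the zero object,
which is the unit). -/
def hallPow (u : HallEl k) : ℕ → HallEl k
  | 0 => clOf (RudRep.zeroRep k)
  | n + 1 => hallMul (hallPow u n) u

namespace RudHom

variable {X Y Z : RudRep k}

lemma comm_e (g : RudHom X Y) (x : X.V₁) : Y.e (g.1.1 x) = g.1.2 (X.e x) :=
  DFunLike.congr_fun g.2.1 x

lemma comm_f (g : RudHom X Y) (x : X.V₁) : Y.f (g.1.1 x) = g.1.2 (X.f x) :=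
  DFunLike.congr_fun g.2.2.1 x

lemma comm_e' (g : RudHom X Y) (y : X.V₂) : Y.e' (g.1.2 y) = g.1.1 (X.e' y) :=
  DFunLike.congr_fun g.2.2.2.1 y

lemma comm_f' (g : RudHom X Y) (y : X.V₂) : Y.f' (g.1.2 y) = g.1.1 (X.f' y) :=
  DFunLike.congr_fun g.2.2.2.2 y

/-- A morphism of representations from pointwise commutation relations. -/
def of (g₁ : X.V₁ →ₗ[k] Y.V₁) (g₂ : X.V₂ →ₗ[k] Y.V₂)
    (he : ∀ x, Y.e (g₁ x) = g₂ (X.e x)) (hf : ∀ x, Y.f (g₁ x) = g₂ (X.f x))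
    (he' : ∀ y, Y.e' (g₂ y) = g₁ (X.e' y)) (hf' : ∀ y, Y.f' (g₂ y) = g₁ (X.f' y)) :
    RudHom X Y :=
  ⟨(g₁, g₂), LinearMap.ext he, LinearMap.ext hf, LinearMap.ext he', LinearMap.ext hf'⟩

/-- Both components of a morphism are bijective. -/
abbrev IsBij (g : RudHom X Y) : Prop :=
  Function.Bijective g.1.1 ∧ Function.Bijective g.1.2

lemma IsBij.comp {g : RudHom Y Z} {h : RudHom X Y} (hg : g.IsBij) (hh : h.IsBij) :
    (g.comp h).IsBij :=
  ⟨hg.1.comp hh.1, hg.2.comp hh.2⟩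

/-- The inverse of a bijective morphism. -/
def inv (g : RudHom X Y) (hg : g.IsBij) : RudHom Y X :=
  let a := LinearEquiv.ofBijective g.1.1 hg.1
  let b := LinearEquiv.ofBijective g.1.2 hg.2
  have ha (x) : g.1.1 (a.symm x) = x := a.apply_symm_apply x
  have hb (x) : g.1.2 (b.symm x) = x := b.apply_symm_apply x
  of a.symm.toLinearMap b.symm.toLinearMap
    (fun y => hg.2.1 (by simp [← comm_e, ha, hb]))
    (fun y => hg.2.1 (by simp [← comm_f, ha, hb]))
    (fun y => hg.1.1 (by simp [← comm_e', ha, hb]))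
    (fun y => hg.1.1 (by simp [← comm_f', ha, hb]))

lemma inv_isBij (g : RudHom X Y) (hg : g.IsBij) : (g.inv hg).IsBij :=
  ⟨(LinearEquiv.ofBijective g.1.1 hg.1).symm.bijective,
    (LinearEquiv.ofBijective g.1.2 hg.2).symm.bijective⟩

lemma inv_comp (g : RudHom X Y) (hg : g.IsBij) : (g.inv hg).comp g = idHom X :=
  Subtype.ext <| Prod.ext
    (LinearMap.ext (LinearEquiv.ofBijective g.1.1 hg.1).symm_apply_apply)
    (LinearMap.ext (LinearEquiv.ofBijective g.1.2 hg.2).symm_apply_apply)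

lemma comp_inv (g : RudHom X Y) (hg : g.IsBij) : g.comp (g.inv hg) = idHom Y :=
  Subtype.ext <| Prod.ext
    (LinearMap.ext (LinearEquiv.ofBijective g.1.1 hg.1).apply_symm_apply)
    (LinearMap.ext (LinearEquiv.ofBijective g.1.2 hg.2).apply_symm_apply)

/-- The kernel of a morphism. -/
def ker (g : RudHom X Y) : RudSub X where
  S₁ := LinearMap.ker g.1.1
  S₂ := LinearMap.ker g.1.2
  he x hx := by rw [LinearMap.mem_ker] at *; rw [← comm_e, hx, map_zero]
  hf x hx := by rw [LinearMap.mem_ker] at *; rw [← comm_f, hx, map_zero]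
  he' x hx := by rw [LinearMap.mem_ker] at *; rw [← comm_e', hx, map_zero]
  hf' x hx := by rw [LinearMap.mem_ker] at *; rw [← comm_f', hx, map_zero]

/-- The image of a morphism. -/
def range (g : RudHom X Y) : RudSub Y where
  S₁ := LinearMap.range g.1.1
  S₂ := LinearMap.range g.1.2
  he := by rintro _ ⟨x, rfl⟩; exact ⟨_, (comm_e g x).symm⟩
  hf := by rintro _ ⟨x, rfl⟩; exact ⟨_, (comm_f g x).symm⟩
  he' := by rintro _ ⟨x, rfl⟩; exact ⟨_, (comm_e' g x).symm⟩
  hf' := by rintro _ ⟨x, rfl⟩; exact ⟨_, (comm_f' g x).symm⟩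

end RudHom

namespace RudIso

variable {X Y Z : RudRep k}

lemma refl (X : RudRep k) : RudIso X X :=
  ⟨RudHom.idHom X, Function.bijective_id, Function.bijective_id⟩

lemma symm (h : RudIso X Y) : RudIso Y X :=
  h.elim fun g hg => ⟨g.inv hg, g.inv_isBij hg⟩

lemma trans (h : RudIso X Y) (h' : RudIso Y Z) : RudIso X Z :=
  h.elim fun g hg => h'.elim fun g' hg' =>
    ⟨g'.comp g, RudHom.IsBij.comp (g := g') (h := g) hg' hg⟩

lemma congr_left (h : RudIso X Y) : RudIso X Z ↔ RudIso Y Z :=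
  ⟨h.symm.trans, h.trans⟩

lemma congr_right (h : RudIso X Y) : RudIso Z X ↔ RudIso Z Y :=
  ⟨fun h' => h'.trans h, fun h' => h'.trans h.symm⟩

lemma card_hom_congr {X' Y' : RudRep k} (hX : RudIso X X') (hY : RudIso Y Y') :
    Nat.card (RudHom X Y) = Nat.card (RudHom X' Y') := by
  obtain ⟨a, ha⟩ := hX
  obtain ⟨b, hb⟩ := hY
  refine Nat.card_congr
    { toFun g := b.comp (g.comp (a.inv ha))
      invFun g := (b.inv hb).comp (g.comp a)
      left_inv g := ?_
      right_inv g := ?_ }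
  · change ((b.inv hb).comp b).comp (g.comp ((a.inv ha).comp a)) = g
    rw [RudHom.inv_comp b hb, RudHom.inv_comp a ha]
    rfl
  · change (b.comp (b.inv hb)).comp (g.comp (a.comp (a.inv ha))) = g
    rw [RudHom.comp_inv b hb, RudHom.comp_inv a ha]
    rfl

lemma card_V₁ (h : RudIso X Y) : Nat.card X.V₁ = Nat.card Y.V₁ :=
  h.elim fun _ hg => Nat.card_congr (Equiv.ofBijective _ hg.1)

lemma out_mk (X : RudRep k) : RudIso (Quot.out (Quot.mk RudIso X)) X :=
  (Equivalence.eqvGen_iff ⟨refl, symm, trans⟩).1 (Quot.eqvGen_exact (Quot.out_eq _))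

end RudIso

lemma isCompl_range_ker_of_bijective {U V W : Type*} [AddCommGroup U] [AddCommGroup V]
    [AddCommGroup W] [Module k U] [Module k V] [Module k W] (f : V →ₗ[k] W) (g : U →ₗ[k] V)
    (h : Function.Bijective (f ∘ₗ g)) : IsCompl (LinearMap.range g) (LinearMap.ker f) := by
  refine IsCompl.of_eq ?_ ?_
  · rw [eq_bot_iff]
    rintro _ ⟨⟨u, rfl⟩, hu⟩
    have : u = 0 := h.1 (by simpa using hu)
    simp [this]
  · rw [eq_top_iff]
    intro v _
    obtain ⟨u, hu⟩ := h.2 (f v)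
    have hu' : f (g u) = f v := hu
    exact Submodule.mem_sup.2 ⟨g u, ⟨u, rfl⟩, v - g u, by simp [hu'], by simp⟩

namespace RudSub

variable {X Y : RudRep k}

lemma ext_iff' {S T : RudSub X} : S = T ↔ S.S₁ = T.S₁ ∧ S.S₂ = T.S₂ := by
  cases S; cases T; simp

instance [Finite k] (X : RudRep k) : Finite (RudSub X) :=
  have : Finite X.V₁ := Module.finite_of_finite k
  have : Finite X.V₂ := Module.finite_of_finite k
  Finite.of_injective (fun S : RudSub X => (S.S₁, S.S₂))
    fun _ _ h => ext_iff'.2 (Prod.ext_iff.1 h)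

/-- The inclusion of a subrepresentation. -/
def incl (S : RudSub X) : RudHom S.toRep X :=
  RudHom.of S.S₁.subtype S.S₂.subtype (fun _ => rfl) (fun _ => rfl) (fun _ => rfl) (fun _ => rfl)

/-- The projection to the quotient by a subrepresentation. -/
def mkQ (S : RudSub X) : RudHom X S.quotRep :=
  RudHom.of S.S₁.mkQ S.S₂.mkQ (fun _ => rfl) (fun _ => rfl) (fun _ => rfl) (fun _ => rfl)

/-- Two subrepresentations are complementary. -/
def Compl (S T : RudSub X) : Prop := IsCompl S.S₁ T.S₁ ∧ IsCompl S.S₂ T.S₂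

lemma Compl.symm {S T : RudSub X} (h : Compl S T) : Compl T S := ⟨h.1.symm, h.2.symm⟩

lemma compl_range_ker {Z : RudRep k} (f : RudHom Y Z) (g : RudHom X Y)
    (h : (f.comp g).IsBij) : Compl g.range f.ker :=
  ⟨isCompl_range_ker_of_bijective _ _ h.1, isCompl_range_ker_of_bijective _ _ h.2⟩

lemma range_incl (S : RudSub X) : S.incl.range = S :=
  ext_iff'.2 ⟨S.S₁.range_subtype, S.S₂.range_subtype⟩

lemma ker_mkQ (S : RudSub X) : S.mkQ.ker = S :=
  ext_iff'.2 ⟨S.S₁.ker_mkQ, S.S₂.ker_mkQ⟩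

lemma Compl.iso_quot {S T : RudSub X} (h : Compl S T) : RudIso T.toRep S.quotRep :=
  ⟨S.mkQ.comp T.incl, (Submodule.quotientEquivOfIsCompl _ _ h.1).symm.bijective,
    (Submodule.quotientEquivOfIsCompl _ _ h.2).symm.bijective⟩

lemma projectionOnto_comm {V W : Type*} [AddCommGroup V] [AddCommGroup W] [Module k V] [Module k W]
    {p q : Submodule k V} {p' q' : Submodule k W} (h : IsCompl p q) (h' : IsCompl p' q')
    (u : V →ₗ[k] W) (hp : ∀ x ∈ p, u x ∈ p') (hq : ∀ x ∈ q, u x ∈ q') (x : V) :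
    u.restrict hp (p.projectionOnto q h x) = p'.projectionOnto q' h' (u x) := by
  obtain ⟨a, b, rfl, _⟩ := Submodule.existsUnique_add_of_isCompl h x
  have ha := Submodule.projectionOnto_apply_left h' ⟨u a, hp a a.2⟩
  have hb := Submodule.projectionOnto_apply_right h' ⟨u b, hq b b.2⟩
  simp only [] at ha hb
  simp [ha, hb, LinearMap.restrict_apply]

/-- The projection onto `S` along a complement `T`. -/
def Compl.proj {S T : RudSub X} (h : Compl S T) : RudHom X S.toRep :=
  RudHom.of (S.S₁.projectionOnto T.S₁ h.1) (S.S₂.projectionOnto T.S₂ h.2)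
    (projectionOnto_comm h.1 h.2 X.e S.he T.he) (projectionOnto_comm h.1 h.2 X.f S.hf T.hf)
    (projectionOnto_comm h.2 h.1 X.e' S.he' T.he') (projectionOnto_comm h.2 h.1 X.f' S.hf' T.hf')

/-- Complements of `S` correspond to retractions of the inclusion of `S`. -/
def complEquivRetraction (S : RudSub X) :
    {T // Compl S T} ≃ {r : RudHom X S.toRep // r.comp S.incl = RudHom.idHom S.toRep} where
  toFun T := ⟨T.2.proj, Subtype.ext <| Prod.ext
    (Submodule.projectionOnto_comp_subtype T.2.1) (Submodule.projectionOnto_comp_subtype T.2.2)⟩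
  invFun r := ⟨r.1.ker,
    LinearMap.isCompl_of_proj fun x => DFunLike.congr_fun (congrArg (fun g => g.1.1) r.2) x,
    LinearMap.isCompl_of_proj fun x => DFunLike.congr_fun (congrArg (fun g => g.1.2) r.2) x⟩
  left_inv T := Subtype.ext <| ext_iff'.2
    ⟨Submodule.ker_projectionOnto T.2.1, Submodule.ker_projectionOnto T.2.2⟩
  right_inv r := Subtype.ext <| Subtype.ext <| Prod.ext
    (LinearMap.projectionOnto_of_proj r.1.1.1
      fun x => DFunLike.congr_fun (congrArg (fun g => g.1.1) r.2) x)
    (LinearMap.projectionOnto_of_proj r.1.1.2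
      fun x => DFunLike.congr_fun (congrArg (fun g => g.1.2) r.2) x)

lemma projectionOnto_add_comp {V W : Type*} [AddCommGroup V] [AddCommGroup W] [Module k V]
    [Module k W] {p q : Submodule k V} (h : IsCompl p q) (r : V →ₗ[k] W) :
    r ∘ₗ p.subtype ∘ₗ p.projectionOnto q h + r ∘ₗ q.subtype ∘ₗ q.projectionOnto p h.symm = r := by
  ext x
  obtain ⟨a, b, rfl, _⟩ := Submodule.existsUnique_add_of_isCompl h x
  simp

lemma projectionOnto_add_comp_subtype {V : Type*} [AddCommGroup V] [Module k V]
    {p q : Submodule k V} (h : IsCompl p q) (g : q →ₗ[k] p) :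
    (p.projectionOnto q h + g ∘ₗ q.projectionOnto p h.symm) ∘ₗ p.subtype = LinearMap.id := by
  ext; simp

lemma projectionOnto_add_comp_subtype_right {V : Type*} [AddCommGroup V] [Module k V]
    {p q : Submodule k V} (h : IsCompl p q) (g : q →ₗ[k] p) :
    (p.projectionOnto q h + g ∘ₗ q.projectionOnto p h.symm) ∘ₗ q.subtype = g := by
  ext; simp

lemma projectionOnto_add_comp_of_proj {V : Type*} [AddCommGroup V] [Module k V]
    {p q : Submodule k V} (h : IsCompl p q) (r : V →ₗ[k] p) (hr : r ∘ₗ p.subtype = LinearMap.id) :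
    p.projectionOnto q h + (r ∘ₗ q.subtype) ∘ₗ q.projectionOnto p h.symm = r := by
  conv_rhs => rw [← projectionOnto_add_comp h r, ← LinearMap.comp_assoc, hr, LinearMap.id_comp]
  rfl

/-- Given complements `S` and `T`, retractions onto `S` correspond to morphisms `T → S`. -/
def retractionEquivHom {S T : RudSub X} (h : Compl S T) :
    {r : RudHom X S.toRep // r.comp S.incl = RudHom.idHom S.toRep} ≃
      RudHom T.toRep S.toRep where
  toFun r := r.1.comp T.incl
  invFun g := ⟨h.proj + g.comp h.symm.proj, Subtype.ext <| Prod.ext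
    (projectionOnto_add_comp_subtype h.1 g.1.1) (projectionOnto_add_comp_subtype h.2 g.1.2)⟩
  left_inv r := Subtype.ext <| Subtype.ext <| Prod.ext
    (projectionOnto_add_comp_of_proj h.1 r.1.1.1 (congrArg (fun g => g.1.1) r.2))
    (projectionOnto_add_comp_of_proj h.2 r.1.1.2 (congrArg (fun g => g.1.2) r.2))
  right_inv g := Subtype.ext <| Prod.ext
    (projectionOnto_add_comp_subtype_right h.1 g.1.1)
    (projectionOnto_add_comp_subtype_right h.2 g.1.2)

lemma card_compl {S T : RudSub X} (h : Compl S T) :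
    Nat.card {T' // Compl S T'} = Nat.card (RudHom T.toRep S.toRep) :=
  Nat.card_congr (S.complEquivRetraction.trans (retractionEquivHom h))

end RudSub

section RepM

lemma repM_e (v : Fin 2 → k) : (repM k).e v = ![v 0, 0] := by
  change Matrix.toLin' _ v = _
  ext i; fin_cases i <;> simp [Matrix.mulVec, dotProduct, Fin.sum_univ_two]

lemma repM_f (v : Fin 2 → k) : (repM k).f v = ![0, v 0] := by
  change Matrix.toLin' _ v = _
  ext i; fin_cases i <;> simp [Matrix.mulVec, dotProduct, Fin.sum_univ_two]

lemma repM_e' (v : Fin 2 → k) : (repM k).e' v = ![0, v 1] := by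
  change Matrix.toLin' _ v = _
  ext i; fin_cases i <;> simp [Matrix.mulVec, dotProduct, Fin.sum_univ_two]

lemma repM_f' (v : Fin 2 → k) : (repM k).f' v = ![0, -v 0] := by
  change Matrix.toLin' _ v = _
  ext i; fin_cases i <;> simp [Matrix.mulVec, dotProduct, Fin.sum_univ_two]

/-- A linear map into `Fin 2 → k` with prescribed components. -/
def pairMap {V : Type} [AddCommGroup V] [Module k V] (a b : V →ₗ[k] k) : V →ₗ[k] (Fin 2 → k) :=
  LinearMap.pi ![a, b]

@[simp] lemma pairMap_apply {V : Type} [AddCommGroup V] [Module k V] (a b : V →ₗ[k] k) (v : V) :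
    pairMap a b v = ![a v, b v] := by
  ext i; fin_cases i <;> rfl

/-- `M` is the projective cover of the simple representation at vertex `1`. -/
def homFromM (X : RudRep k) : RudHom (repM k) X ≃ X.V₁ where
  toFun g := g.1.1 (![1, 0] : Fin 2 → k)
  invFun x :=
    let a : (Fin 2 → k) →ₗ[k] X.V₁ := Fintype.linearCombination k ![x, X.e' (X.f x)]
    let b : (Fin 2 → k) →ₗ[k] X.V₂ := Fintype.linearCombination k ![X.e x, X.f x]
    have ha (v : Fin 2 → k) : a v = v 0 • x + v 1 • X.e' (X.f x) := by
      simp [a, Fintype.linearCombination_apply]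
    have hb (v : Fin 2 → k) : b v = v 0 • X.e x + v 1 • X.f x := by
      simp [b, Fintype.linearCombination_apply]
    RudHom.of (X := repM k) a b
      (fun v : Fin 2 → k =>
        have h : X.e (a v) = b ![v 0, 0] := by simp [ha, hb, X.ee'_apply]
        h.trans (congrArg b (repM_e v).symm))
      (fun v : Fin 2 → k =>
        have h : X.f (a v) = b ![0, v 0] := by simp [ha, hb, X.e'f_apply, X.ff'_apply]
        h.trans (congrArg b (repM_f v).symm))
      (fun v : Fin 2 → k =>
        have h : X.e' (b v) = a ![0, v 1] := by simp [ha, hb, X.e'e_apply]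
        h.trans (congrArg a (repM_e' v).symm))
      (fun v : Fin 2 → k =>
        have h : X.f' (b v) = a ![0, -v 0] := by simp [ha, hb, X.e'f_apply, X.f'f_apply]
        h.trans (congrArg a (repM_f' v).symm))
  left_inv g := by
    let a : (Fin 2 → k) →ₗ[k] X.V₁ := g.1.1
    let b : (Fin 2 → k) →ₗ[k] X.V₂ := g.1.2
    have he : X.e (a ![1, 0]) = b ![1, 0] := (g.comm_e _).trans (congrArg b (repM_e ![1, 0]))
    have hf : X.f (a ![1, 0]) = b ![0, 1] := (g.comm_f _).trans (congrArg b (repM_f ![1, 0]))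
    have he' : X.e' (b ![0, 1]) = a ![0, 1] :=
      (g.comm_e' _).trans (congrArg a (repM_e' ![0, 1]))
    have hv (v : Fin 2 → k) : v = v 0 • ![1, 0] + v 1 • ![0, 1] := by
      ext i; fin_cases i <;> simp
    refine Subtype.ext <| Prod.ext (LinearMap.ext fun v : Fin 2 → k => ?_)
      (LinearMap.ext fun v : Fin 2 → k => ?_)
    · change Fintype.linearCombination k ![a ![1, 0], X.e' (X.f (a ![1, 0]))] v = a v
      conv_rhs => rw [hv v, map_add, map_smul, map_smul, ← he', ← hf]
      simp [Fintype.linearCombination_apply]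
    · change Fintype.linearCombination k ![X.e (a ![1, 0]), X.f (a ![1, 0])] v = b v
      conv_rhs => rw [hv v, map_add, map_smul, map_smul, ← he, ← hf]
      simp [Fintype.linearCombination_apply]
  right_inv x := by
    change Fintype.linearCombination k ![x, X.e' (X.f x)] ![1, 0] = x
    simp [Fintype.linearCombination_apply]

/-- `M` is the injective hull of the simple representation at vertex `1`. -/
def homToM (X : RudRep k) : RudHom X (repM k) ≃ Module.Dual k X.V₁ where
  toFun g := (LinearMap.proj 1 : (Fin 2 → k) →ₗ[k] k) ∘ₗ g.1.1
  invFun φ :=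
    let a : X.V₁ →ₗ[k] (Fin 2 → k) := pairMap (-(φ ∘ₗ X.f' ∘ₗ X.e)) φ
    let b : X.V₂ →ₗ[k] (Fin 2 → k) := pairMap (-(φ ∘ₗ X.f')) (φ ∘ₗ X.e')
    RudHom.of (Y := repM k) a b
      (fun v => (repM_e (a v)).trans
        (show ![a v 0, 0] = b (X.e v) by simp [a, b, X.e'e_apply]))
      (fun v => (repM_f (a v)).trans
        (show ![0, a v 0] = b (X.f v) by simp [a, b, X.e'f_apply, X.f'f_apply]))
      (fun v => (repM_e' (b v)).trans
        (show ![0, b v 1] = a (X.e' v) by simp [a, b, X.ee'_apply]))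
      (fun v => (repM_f' (b v)).trans
        (show ![0, -b v 0] = a (X.f' v) by simp [a, b, X.ef'_apply, X.f'f_apply]))
  left_inv g := by
    let a : X.V₁ →ₗ[k] (Fin 2 → k) := g.1.1
    let b : X.V₂ →ₗ[k] (Fin 2 → k) := g.1.2
    have he (x) : ![a x 0, 0] = b (X.e x) := (repM_e (a x)).symm.trans (g.comm_e x)
    have he' (y) : ![0, b y 1] = a (X.e' y) := (repM_e' (b y)).symm.trans (g.comm_e' y)
    have hf' (y) : ![0, -b y 0] = a (X.f' y) := (repM_f' (b y)).symm.trans (g.comm_f' y)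
    let φ : Module.Dual k X.V₁ := LinearMap.proj 1 ∘ₗ a
    refine Subtype.ext <| Prod.ext (LinearMap.ext fun x => ?_) (LinearMap.ext fun y => ?_)
    · change pairMap (-(φ ∘ₗ X.f' ∘ₗ X.e)) φ x = a x
      ext i; fin_cases i <;> simp [φ, ← hf', ← he]
    · change pairMap (-(φ ∘ₗ X.f')) (φ ∘ₗ X.e') y = b y
      ext i; fin_cases i <;> simp [φ, ← hf', ← he']
  right_inv φ := by
    ext x
    change (pairMap (-(φ ∘ₗ X.f' ∘ₗ X.e)) φ x) 1 = φ x
    simp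

end RepM

lemma card_hom_repM_comm [Finite k] (X : RudRep k) :
    Nat.card (RudHom (repM k) X) = Nat.card (RudHom X (repM k)) := by
  rw [Nat.card_congr (homFromM X), Nat.card_congr (homToM X)]
  exact Nat.card_congr (LinearEquiv.ofFinrankEq _ _ Subspace.dual_finrank_eq.symm).toEquiv

lemma card_hom_from_repM_pos [Finite k] (X : RudRep k) : 0 < Nat.card (RudHom (repM k) X) := by
  have : Finite X.V₁ := Module.finite_of_finite k
  rw [Nat.card_congr (homFromM X)]
  exact Nat.card_pos

lemma exists_compl_of_iso_repM {E : RudRep k} (S : RudSub E) (h : RudIso S.toRep (repM k)) :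
    ∃ T, S.Compl T := by
  obtain ⟨g, hg⟩ := h
  obtain ⟨ψ, hψ⟩ := LinearMap.exists_extend (p := S.S₁) (homToM S.toRep g)
  have hr : ((homToM E).symm ψ).comp S.incl = g := by
    apply (homToM S.toRep).injective
    change (homToM E ((homToM E).symm ψ)) ∘ₗ S.S₁.subtype = _
    rw [Equiv.apply_symm_apply, hψ]
  have hc := RudSub.compl_range_ker _ _ (hr ▸ hg : (((homToM E).symm ψ).comp S.incl).IsBij)
  rw [S.range_incl] at hc
  exact ⟨_, hc⟩

lemma exists_compl_of_quot_iso_repM {E : RudRep k} (T : RudSub E)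
    (h : RudIso T.quotRep (repM k)) : ∃ S, T.Compl S := by
  obtain ⟨g, hg⟩ := h.symm
  obtain ⟨x, hx⟩ := T.S₁.mkQ_surjective (homFromM T.quotRep g)
  have hr : T.mkQ.comp ((homFromM E).symm x) = g := by
    apply (homFromM T.quotRep).injective
    change T.S₁.mkQ (homFromM E ((homFromM E).symm x)) = _
    rw [Equiv.apply_symm_apply, hx]
  have hc := RudSub.compl_range_ker _ _ (hr ▸ hg : (T.mkQ.comp ((homFromM E).symm x)).IsBij)
  rw [T.ker_mkQ] at hc
  exact ⟨_, hc.symm⟩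

/-- If every subrepresentation isomorphic to `A` with quotient isomorphic to `B` has a complement,
then direct sum decompositions into copies of `A` and `B` are counted by Hall numbers. -/
lemma card_compl_pairs [Finite k] (A B E : RudRep k)
    (hE : ∀ S : RudSub E, RudIso S.toRep A → RudIso S.quotRep B → ∃ T, S.Compl T) :
    Nat.card {p : RudSub E × RudSub E // p.1.Compl p.2 ∧ RudIso p.1.toRep A ∧ RudIso p.2.toRep B}
      = hallNum B A E * Nat.card (RudHom B A) := by
  let α := {S : RudSub E // RudIso S.toRep A ∧ RudIso S.quotRep B}
  let e : {p : RudSub E × RudSub E //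
      p.1.Compl p.2 ∧ RudIso p.1.toRep A ∧ RudIso p.2.toRep B} ≃ Σ S : α, {T // S.1.Compl T} :=
    { toFun p := ⟨⟨p.1.1, p.2.2.1, p.2.1.iso_quot.symm.trans p.2.2.2⟩, p.1.2, p.2.1⟩
      invFun q := ⟨(q.1.1, q.2.1), q.2.2, q.1.2.1, q.2.2.iso_quot.trans q.1.2.2⟩
      left_inv _ := rfl
      right_inv _ := rfl }
  have := Fintype.ofFinite α
  have key (S : α) : Nat.card {T // S.1.Compl T} = Nat.card (RudHom B A) := by
    obtain ⟨T, hT⟩ := hE S.1 S.2.1 S.2.2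
    rw [RudSub.card_compl hT]
    exact RudIso.card_hom_congr (hT.iso_quot.trans S.2.2) S.2.1
  rw [Nat.card_congr e, Nat.card_sigma, Finset.sum_congr rfl fun S _ => key S, Finset.sum_const,
    smul_eq_mul, Finset.card_univ, ← Nat.card_eq_fintype_card]
  rfl

lemma hallNum_comm_of_iso_repM [Finite k] {N : RudRep k} (hN : RudIso N (repM k))
    (B E : RudRep k) : hallNum N B E = hallNum B N E := by
  have h₁ := card_compl_pairs N B E fun S h _ => exists_compl_of_iso_repM S (h.trans hN)
  have h₂ := card_compl_pairs B N E fun T _ h => exists_compl_of_quot_iso_repM T (h.trans hN)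
  have hswap : Nat.card {p : RudSub E × RudSub E //
        p.1.Compl p.2 ∧ RudIso p.1.toRep N ∧ RudIso p.2.toRep B} =
      Nat.card {p : RudSub E × RudSub E //
        p.1.Compl p.2 ∧ RudIso p.1.toRep B ∧ RudIso p.2.toRep N} :=
    Nat.card_congr <| (Equiv.prodComm _ _).subtypeEquiv fun p =>
      ⟨fun h => ⟨h.1.symm, h.2.2, h.2.1⟩, fun h => ⟨h.1.symm, h.2.2, h.2.1⟩⟩
  have hB : RudIso B B := RudIso.refl B
  rw [h₁, h₂, RudIso.card_hom_congr hB hN, RudIso.card_hom_congr hN hB, ← card_hom_repM_comm] at hswap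
  exact (Nat.eq_of_mul_eq_mul_right (card_hom_from_repM_pos B) hswap).symm

lemma RudIso.sigma {X Y : RudRep k} (h : RudIso X Y) : RudIso X.sigma Y.sigma :=
  h.elim fun g hg =>
    ⟨RudHom.of (X := X.sigma) (Y := Y.sigma) g.1.2 g.1.1 g.comm_e' g.comm_f' g.comm_e g.comm_f,
      hg.2, hg.1⟩

/-- The subrepresentation of `σ X` with the same underlying spaces. -/
def RudSub.sigma {X : RudRep k} (S : RudSub X) : RudSub X.sigma :=
  ⟨S.S₂, S.S₁, S.he', S.hf', S.he, S.hf⟩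

lemma hallNum_sigma (A B E : RudRep k) : hallNum A.sigma B.sigma E.sigma = hallNum A B E :=
  Nat.card_congr
    { toFun S := ⟨S.1.sigma, S.2.1.sigma, S.2.2.sigma⟩
      invFun S := ⟨S.1.sigma, S.2.1.sigma, S.2.2.sigma⟩
      left_inv _ := rfl
      right_inv _ := rfl }

lemma hallNum_comm_of_iso_repM' [Finite k] {N : RudRep k} (hN : RudIso N (repM' k))
    (B E : RudRep k) : hallNum N B E = hallNum B N E := by
  rw [← hallNum_sigma, ← hallNum_sigma B]
  exact hallNum_comm_of_iso_repM hN.sigma _ _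

lemma clOf_central_of_hallNum_comm (M : RudRep k)
    (hM : ∀ N, RudIso N M → ∀ B E, hallNum N B E = hallNum B N E) (u : HallEl k) :
    hallMul (clOf M) u = hallMul u (clOf M) := by
  funext C
  have hl (A : IsoCl k) (hA : A ≠ Quot.mk _ M) :
      ∑ᶠ B, clOf M A * u B * hallC A B C = 0 := by
    simp [clOf, hA.symm]
  have hr (A : IsoCl k) : ∑ᶠ B, u A * clOf M B * hallC A B C =
      u A * hallC A (Quot.mk _ M) C := by
    rw [finsum_eq_single _ (Quot.mk _ M) fun B hB => by simp [clOf, hB.symm]]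
    simp [clOf]
  simp only [hallMul, hr]
  rw [finsum_eq_single _ _ hl]
  refine finsum_congr fun B => ?_
  simp [clOf, hallC, hM _ (RudIso.out_mk M)]

/-- The classes `[M]` and `[M']` are central in the Hall algebra of
the category of finite-dimensional representations of `Q_Rud` over `F_q`. -/
theorem M_and_M'_central_in_hall_algebra (F : Type) [Field F] [Fintype F] :
    (∀ u : HallEl F, hallMul (clOf (repM F)) u = hallMul u (clOf (repM F))) ∧
    (∀ u : HallEl F, hallMul (clOf (repM' F)) u = hallMul u (clOf (repM' F))) := by
  exact ⟨clOf_central_of_hallNum_comm _ fun _ h => hallNum_comm_of_iso_repM h,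
    clOf_central_of_hallNum_comm _ fun _ h => hallNum_comm_of_iso_repM' h⟩
end
end

section
/- Fix a prime power q, nonnegative integers a and b, and a monic irreducible polynomial π of degree d over F_q. The number of da × db matrices M̄ over F_q such that the block matrix [[M_π(a), M̄], [0, M_π(b)]] is similar (conjugate by an element of GL_{d(a+b)}(F_q)) to M_π(a+b) equals q^{d²ab}(1 − q^{−d}) if a ≥ 1 and b ≥ 1, and equals 1 if a = 0 or b = 0. -/
open scoped Classical

noncomputable section

variable {k : Type} [Field k]

/-- The `d × d` companion matrix of a monic polynomial of degree `d`. -/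
def companionMat (d : ℕ) (φ : Polynomial k) : Matrix (Fin d) (Fin d) k :=
  Matrix.of fun i j =>
    if (j : ℕ) + 1 = d then -φ.coeff (i : ℕ) else if (i : ℕ) = (j : ℕ) + 1 then 1 else 0

/-- The `dn × dn` block matrix with `n` diagonal blocks equal to `C` and `d × d`
identity blocks on the superdiagonal. -/
def Mblock {d : ℕ} (C : Matrix (Fin d) (Fin d) k) (n : ℕ) :
    Matrix (Fin n × Fin d) (Fin n × Fin d) k :=
  Matrix.of fun p q =>
    if p.1 = q.1 then C p.2 q.2
    else if (q.1 : ℕ) = (p.1 : ℕ) + 1 ∧ p.2 = q.2 then 1 else 0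

/-- Two square matrices (over possibly different index types) are similar if they are
conjugate by an invertible change of basis. -/
def MatSimilar {I J : Type} [Fintype I] [Fintype J] [DecidableEq I] [DecidableEq J]
    (A : Matrix I I k) (B : Matrix J J k) : Prop :=
  ∃ (P : Matrix I J k) (Q : Matrix J I k), P * Q = 1 ∧ Q * P = 1 ∧ Q * A * P = B

section DividedDifference

open Polynomial

variable {m n : Type*} [Fintype m] [DecidableEq m] [Fintype n] [DecidableEq n]

/-- The upper right block of `p` evaluated at the block upper triangular matrix `[[P, X], [0, Q]]`. -/
def divDiff (P : Matrix m m k) (Q : Matrix n n k) (p : k[X]) (X : Matrix m n k) : Matrix m n k :=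
  (aeval (Matrix.fromBlocks P X 0 Q) p).toBlocks₁₂

variable (P : Matrix m m k) (Q : Matrix n n k)

theorem aeval_fromBlocks (p : k[X]) (X : Matrix m n k) :
    aeval (Matrix.fromBlocks P X 0 Q) p =
      Matrix.fromBlocks (aeval P p) (divDiff P Q p X) 0 (aeval Q p) := by
  suffices h : ∃ T, aeval (Matrix.fromBlocks P X 0 Q) p =
      Matrix.fromBlocks (aeval P p) T 0 (aeval Q p) by
    obtain ⟨T, hT⟩ := h
    rw [divDiff, hT, Matrix.toBlocks_fromBlocks₁₂]
  induction p using Polynomial.induction_on' with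
  | add p q hp hq =>
    obtain ⟨T, hT⟩ := hp
    obtain ⟨U, hU⟩ := hq
    exact ⟨T + U, by simp [hT, hU, Matrix.fromBlocks_add]⟩
  | monomial e c =>
    induction e with
    | zero =>
      refine ⟨0, ?_⟩
      simp [Algebra.algebraMap_eq_smul_one, ← Matrix.fromBlocks_one, Matrix.fromBlocks_smul]
    | succ e ih =>
      obtain ⟨T, hT⟩ := ih
      refine ⟨aeval P (monomial e c) * X + T * Q, ?_⟩
      rw [← monomial_mul_X, map_mul, hT, aeval_X, Matrix.fromBlocks_multiply]
      simp only [map_mul, aeval_X, Matrix.mul_zero, Matrix.zero_mul, add_zero, zero_add]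

@[simp]
theorem divDiff_C (c : k) (X : Matrix m n k) : divDiff P Q (C c) X = 0 := by
  simp [divDiff, Algebra.algebraMap_eq_smul_one, ← Matrix.fromBlocks_one, Matrix.fromBlocks_smul]

@[simp]
theorem divDiff_X (X : Matrix m n k) : divDiff P Q Polynomial.X X = X := by
  simp [divDiff]

theorem divDiff_add (p q : k[X]) (X : Matrix m n k) :
    divDiff P Q (p + q) X = divDiff P Q p X + divDiff P Q q X := by
  ext i j
  simp [divDiff, Matrix.toBlocks₁₂]

theorem divDiff_mul (p q : k[X]) (X : Matrix m n k) :
    divDiff P Q (p * q) X = aeval P p * divDiff P Q q X + divDiff P Q p X * aeval Q q := by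
  rw [divDiff, map_mul, aeval_fromBlocks, aeval_fromBlocks, Matrix.fromBlocks_multiply,
    Matrix.toBlocks_fromBlocks₁₂]

/-- Induction principle for polynomials with a step for multiplication by the variable. -/
theorem polynomial_induction_mul_X {motive : k[X] → Prop} (p : k[X]) (C : ∀ c, motive (C c))
    (add : ∀ p q, motive p → motive q → motive (p + q))
    (mul_X : ∀ p, motive p → motive (p * X)) : motive p := by
  induction p using Polynomial.induction_on' with
  | add p q hp hq => exact add p q hp hq
  | monomial e c =>
    induction e with
    | zero => exact C c
    | succ e ih => rw [← monomial_mul_X]; exact mul_X _ ih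

/-- `divDiff` as a linear map in the upper right block. -/
def divDiffLinear (p : k[X]) : Matrix m n k →ₗ[k] Matrix m n k where
  toFun := divDiff P Q p
  map_add' X Y := by
    induction p using polynomial_induction_mul_X with
    | C c => simp
    | add p q hp hq => simp only [divDiff_add, hp, hq]; abel
    | mul_X p hp =>
      simp only [divDiff_mul, divDiff_X, hp, Matrix.mul_add, Matrix.add_mul]; abel
  map_smul' c X := by
    induction p using polynomial_induction_mul_X with
    | C c => simp
    | add p q hp hq => simp only [divDiff_add, hp, hq, smul_add]
    | mul_X p hp => simp only [divDiff_mul, divDiff_X, hp]; simp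

theorem mul_divDiff_add (p : k[X]) (X : Matrix m n k) :
    P * divDiff P Q p X + X * aeval Q p = aeval P p * X + divDiff P Q p X * Q := by
  have h := congrArg (fun r => divDiff P Q r X) (mul_comm Polynomial.X p)
  simpa only [divDiff_mul, divDiff_X, aeval_X] using h

theorem divDiff_self_of_commute (p : k[X]) {X : Matrix m m k} (h : Commute P X) :
    divDiff P P p X = aeval P (derivative p) * X := by
  induction p using polynomial_induction_mul_X with
  | C c => simp
  | add p q hp hq => simp only [divDiff_add, hp, hq, map_add, Matrix.add_mul]
  | mul_X p hp =>
    rw [divDiff_mul, hp, divDiff_X, derivative_mul, derivative_X, mul_one, map_add, map_mul,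
      aeval_X, Matrix.add_mul, Matrix.mul_assoc, Matrix.mul_assoc, h.eq, add_comm]

end DividedDifference

section Cyclic

open Polynomial

variable {I J : Type} [Fintype I] [DecidableEq I] [Fintype J] [DecidableEq J]

/-- The orbit map `p ↦ p(A) v`. -/
def orbitMap (A : Matrix I I k) (v : I → k) : k[X] →ₗ[k] (I → k) where
  toFun p := (aeval A p).mulVec v
  map_add' p q := by simp [Matrix.add_mulVec]
  map_smul' c p := by simp [Matrix.smul_mulVec]

theorem orbitMap_mul (A : Matrix I I k) (v : I → k) (p q : k[X]) :
    orbitMap A v (p * q) = (aeval A p).mulVec (orbitMap A v q) := by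
  simp [orbitMap]

theorem orbitMap_eq_zero_iff {φ : k[X]} (hφ : Irreducible φ) {e : ℕ} {A : Matrix I I k}
    {v : I → k} (hA : aeval A (φ ^ (e + 1)) = 0) (hv : orbitMap A v (φ ^ e) ≠ 0) (p : k[X]) :
    orbitMap A v p = 0 ↔ φ ^ (e + 1) ∣ p := by
  constructor
  · intro hp
    have hφA : orbitMap A v (φ ^ (e + 1)) = 0 := by simp [orbitMap, -map_pow, hA]
    have hg : orbitMap A v (EuclideanDomain.gcd (φ ^ (e + 1)) p) = 0 := by
      rw [EuclideanDomain.gcd_eq_gcd_ab, map_add, mul_comm (φ ^ (e + 1)), mul_comm p,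
        orbitMap_mul, orbitMap_mul, hp, hφA]
      simp
    obtain ⟨i, hi, hassoc⟩ := (dvd_prime_pow hφ.prime _).1
      (EuclideanDomain.gcd_dvd_left (φ ^ (e + 1)) p)
    rcases hi.lt_or_eq with hlt | rfl
    · refine absurd ?_ hv
      obtain ⟨r, hr⟩ := hassoc.dvd.trans (pow_dvd_pow φ (Nat.lt_succ_iff.1 hlt))
      rw [hr, mul_comm, orbitMap_mul, hg, Matrix.mulVec_zero]
    · exact hassoc.symm.dvd.trans (EuclideanDomain.gcd_dvd_right _ _)
  · rintro ⟨r, rfl⟩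
    rw [orbitMap_mul, hA, Matrix.zero_mulVec]

theorem orbitMap_surjective {φ : k[X]} {A : Matrix I I k} {v : I → k} (hφ : φ ≠ 0)
    (h : ∀ p, orbitMap A v p = 0 ↔ φ ∣ p) (hcard : Fintype.card I = φ.natDegree) :
    Function.Surjective (orbitMap A v) := by
  let f : (Fin φ.natDegree → k) →ₗ[k] (I → k) :=
    orbitMap A v ∘ₗ (degreeLT k φ.natDegree).subtype ∘ₗ (degreeLTEquiv k φ.natDegree).symm
  have hinj : Function.Injective f := by
    rw [← LinearMap.ker_eq_bot, LinearMap.ker_eq_bot']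
    intro x hx
    set y := (degreeLTEquiv k φ.natDegree).symm x with hy
    have hdvd : φ ∣ (y : k[X]) := (h _).1 hx
    have hdeg : (y : k[X]).degree < φ.degree := by
      rw [degree_eq_natDegree hφ]
      exact mem_degreeLT.1 y.2
    have hy0 : y = 0 := Subtype.ext (eq_zero_of_dvd_of_degree_lt hdvd hdeg)
    simpa [hy] using hy0
  have hsurj : Function.Surjective f :=
    (LinearMap.injective_iff_surjective_of_finrank_eq_finrank (by simp [hcard])).1 hinj
  intro w
  obtain ⟨x, hx⟩ := hsurj w
  exact ⟨_, hx⟩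

theorem matSimilar_of_intertwining {A : Matrix I I k} {B : Matrix J J k}
    (e : (I → k) ≃ₗ[k] (J → k)) (h : ∀ w, e (A.mulVec w) = B.mulVec (e w)) :
    MatSimilar A B := by
  have hPQ : LinearMap.toMatrix' e.symm.toLinearMap * LinearMap.toMatrix' e.toLinearMap = 1 := by
    rw [← LinearMap.toMatrix'_comp]; simp
  have hQP : LinearMap.toMatrix' e.toLinearMap * LinearMap.toMatrix' e.symm.toLinearMap = 1 := by
    rw [← LinearMap.toMatrix'_comp]; simp
  refine ⟨LinearMap.toMatrix' e.symm.toLinearMap, LinearMap.toMatrix' e.toLinearMap, hPQ, hQP, ?_⟩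
  have hcomm : LinearMap.toMatrix' e.toLinearMap * A = B * LinearMap.toMatrix' e.toLinearMap := by
    apply Matrix.toLin'.injective
    refine LinearMap.ext fun w => ?_
    simpa [Matrix.toLin'_mul] using h w
  rw [hcomm, Matrix.mul_assoc, hQP, Matrix.mul_one]

theorem matSimilar_of_isEmpty [IsEmpty I] [IsEmpty J] (A : Matrix I I k) (B : Matrix J J k) :
    MatSimilar A B :=
  ⟨0, 0, Subsingleton.elim _ _, Subsingleton.elim _ _, Subsingleton.elim _ _⟩

theorem matSimilar_of_aeval_pow {φ : k[X]} (hφ : Irreducible φ) {e : ℕ} {A : Matrix I I k}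
    {B : Matrix J J k} (hI : Fintype.card I = (e + 1) * φ.natDegree)
    (hJ : Fintype.card J = (e + 1) * φ.natDegree)
    (hA : aeval A (φ ^ (e + 1)) = 0) (hA' : aeval A (φ ^ e) ≠ 0)
    (hB : aeval B (φ ^ (e + 1)) = 0) (hB' : aeval B (φ ^ e) ≠ 0) : MatSimilar A B := by
  have key : ∀ {L : Type} [Fintype L] [DecidableEq L] {M : Matrix L L k},
      aeval M (φ ^ e) ≠ 0 → ∃ v, orbitMap M v (φ ^ e) ≠ 0 := by
    intro L _ _ M hM
    by_contra! hzero
    exact hM (Matrix.ext_of_mulVec_single fun i => by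
      rw [Matrix.zero_mulVec]; exact hzero (Pi.single i 1))
  obtain ⟨v, hv⟩ := key hA'
  obtain ⟨w, hw⟩ := key hB'
  have hkA := orbitMap_eq_zero_iff hφ hA hv
  have hkB := orbitMap_eq_zero_iff hφ hB hw
  have hne : φ ^ (e + 1) ≠ 0 := pow_ne_zero _ hφ.ne_zero
  have hsA := orbitMap_surjective hne hkA (by rw [hI, natDegree_pow])
  have hsB := orbitMap_surjective hne hkB (by rw [hJ, natDegree_pow])
  have hker : LinearMap.ker (orbitMap A v) = LinearMap.ker (orbitMap B w) := by
    ext p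
    rw [LinearMap.mem_ker, LinearMap.mem_ker, hkA, hkB]
  let f := ((orbitMap A v).quotKerEquivOfSurjective hsA).symm ≪≫ₗ
    Submodule.quotEquivOfEq _ _ hker ≪≫ₗ (orbitMap B w).quotKerEquivOfSurjective hsB
  have hf : ∀ p, f (orbitMap A v p) = orbitMap B w p := by
    intro p
    have hsymm : ((orbitMap A v).quotKerEquivOfSurjective hsA).symm (orbitMap A v p) =
        Submodule.Quotient.mk p := by
      rw [LinearEquiv.symm_apply_eq]
      rfl
    simp only [f, LinearEquiv.trans_apply, hsymm]
    rfl
  refine matSimilar_of_intertwining f fun u => ?_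
  obtain ⟨p, rfl⟩ := hsA u
  have hXA := orbitMap_mul A v X p
  have hXB := orbitMap_mul B w X p
  rw [aeval_X] at hXA hXB
  rw [← hXA, hf, hf, hXB]

theorem MatSimilar.aeval_eq_zero {A : Matrix I I k} {B : Matrix J J k} (h : MatSimilar A B)
    {p : k[X]} (hA : aeval A p = 0) : aeval B p = 0 := by
  obtain ⟨P, Q, hPQ, hQP, rfl⟩ := h
  suffices hconj : aeval (Q * A * P) p = Q * aeval A p * P by
    rw [hconj, hA, Matrix.mul_zero, Matrix.zero_mul]
  clear hA
  induction p using polynomial_induction_mul_X with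
  | C c => simp [Algebra.algebraMap_eq_smul_one, hQP]
  | add p q hp hq => simp only [map_add, hp, hq, Matrix.mul_add, Matrix.add_mul]
  | mul_X p hp =>
    rw [map_mul, hp, aeval_X, map_mul, aeval_X]
    calc Q * aeval A p * P * (Q * A * P) = Q * aeval A p * (P * Q) * A * P := by
          simp only [Matrix.mul_assoc]
      _ = Q * (aeval A p * A) * P := by rw [hPQ]; simp only [Matrix.mul_assoc, Matrix.one_mul]

end Cyclic

section Companion

open Polynomial

variable {φ : k[X]}

/-- The first standard basis vector, which is cyclic for the companion matrix. -/
def firstVec (d : ℕ) : Fin d → k := fun i => if (i : ℕ) = 0 then 1 else 0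

theorem orbitMap_companionMat_X_pow {d i : ℕ} (hi : i < d) :
    orbitMap (companionMat d φ) (firstVec d) (X ^ i) = Pi.single ⟨i, hi⟩ 1 := by
  induction i with
  | zero =>
    ext j
    simp [orbitMap, firstVec, Pi.single_apply, Fin.ext_iff]
  | succ i ih =>
    rw [pow_succ', orbitMap_mul, ih (by omega), aeval_X, Matrix.mulVec_single_one]
    ext j
    simp [companionMat, Pi.single_apply, Fin.ext_iff, hi.ne]

theorem orbitMap_companionMat_surjective (d : ℕ) :
    Function.Surjective (orbitMap (companionMat d φ) (firstVec d)) := by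
  intro w
  refine ⟨∑ i : Fin d, w i • X ^ (i : ℕ), ?_⟩
  simp only [map_sum, map_smul, orbitMap_companionMat_X_pow (Fin.is_lt _), Fin.eta]
  exact (pi_eq_sum_univ' w).symm

theorem eq_zero_of_commute_companionMat {d : ℕ} {Z : Matrix (Fin d) (Fin d) k}
    (hZ : Commute (companionMat d φ) Z) (h : Z.mulVec (firstVec d) = 0) : Z = 0 := by
  have hcomm : ∀ p : k[X], Commute Z (aeval (companionMat d φ) p) := by
    intro p
    induction p using polynomial_induction_mul_X with
    | C c => rw [aeval_C]; exact Algebra.commute_algebraMap_right _ _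
    | add p q hp hq => rw [map_add]; exact hp.add_right hq
    | mul_X p hp => rw [map_mul, aeval_X]; exact hp.mul_right hZ.symm
  refine Matrix.ext_of_mulVec_single fun i => ?_
  obtain ⟨p, hp⟩ := orbitMap_companionMat_surjective (φ := φ) d (Pi.single i 1)
  rw [← hp, Matrix.zero_mulVec]
  change Z.mulVec ((aeval (companionMat d φ) p).mulVec (firstVec d)) = 0
  rw [Matrix.mulVec_mulVec, (hcomm p).eq, ← Matrix.mulVec_mulVec, h, Matrix.mulVec_zero]

theorem aeval_companionMat {d : ℕ} (hφ : φ.Monic) (hdeg : φ.natDegree = d) (hd : 0 < d) :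
    aeval (companionMat d φ) φ = 0 := by
  refine eq_zero_of_commute_companionMat (φ := φ) ?_ ?_
  · have h : Commute (aeval (companionMat d φ) X) (aeval (companionMat d φ) φ) :=
      (Commute.all X φ).map (aeval (companionMat d φ))
    rwa [aeval_X] at h
  · change orbitMap (companionMat d φ) (firstVec d) φ = 0
    have htop : orbitMap (companionMat d φ) (firstVec d) (X ^ d) =
        fun i : Fin d => -φ.coeff (i : ℕ) := by
      obtain ⟨e, rfl⟩ : ∃ e, d = e + 1 := ⟨_, (Nat.succ_pred_eq_of_pos hd).symm⟩
      rw [pow_succ', orbitMap_mul, orbitMap_companionMat_X_pow (Nat.lt_succ_self e), aeval_X,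
        Matrix.mulVec_single_one]
      ext j
      simp [companionMat]
    have hsum : φ = X ^ d + ∑ i : Fin d, φ.coeff (i : ℕ) • X ^ (i : ℕ) := by
      conv_lhs => rw [hφ.as_sum, hdeg, Finset.sum_range]
      simp only [smul_eq_C_mul]
    rw [congrArg (orbitMap (companionMat d φ) (firstVec d)) hsum, map_add, htop, map_sum]
    simp only [map_smul, orbitMap_companionMat_X_pow (Fin.is_lt _), Fin.eta]
    rw [← pi_eq_sum_univ' (fun i : Fin d => φ.coeff (i : ℕ))]
    ext i
    simp

end Companion

section Block

open Polynomial

variable {ι κ μ ρ σ τ : Type*}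

/-- The `(i, j)` block of a block matrix. -/
def blockAt {R : Type*} (M : Matrix (ι × ρ) (κ × σ) R) (i : ι) (j : κ) : Matrix ρ σ R :=
  M.submatrix (Prod.mk i) (Prod.mk j)

theorem blockAt_ext {R : Type*} {M N : Matrix (ι × ρ) (κ × σ) R}
    (h : ∀ i j, blockAt M i j = blockAt N i j) : M = N := by
  ext ⟨i, r⟩ ⟨j, s⟩
  exact congrFun (congrFun (h i j) r) s

@[simp]
theorem blockAt_zero (i : ι) (j : κ) : blockAt (0 : Matrix (ι × ρ) (κ × σ) k) i j = 0 := rfl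

@[simp]
theorem blockAt_add (M N : Matrix (ι × ρ) (κ × σ) k) (i : ι) (j : κ) :
    blockAt (M + N) i j = blockAt M i j + blockAt N i j := rfl

theorem blockAt_mul [Fintype κ] [Fintype σ] (M : Matrix (ι × ρ) (κ × σ) k)
    (N : Matrix (κ × σ) (μ × τ) k) (i : ι) (j : μ) :
    blockAt (M * N) i j = ∑ l, blockAt M i l * blockAt N l j := by
  ext r s
  simp [blockAt, Matrix.mul_apply, Fintype.sum_prod_type, Matrix.sum_apply]

theorem blockAt_algebraMap [Fintype ι] [DecidableEq ι] [Fintype ρ] [DecidableEq ρ] (c : k)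
    (i j : ι) :
    blockAt (algebraMap k (Matrix (ι × ρ) (ι × ρ) k) c) i j =
      if i = j then algebraMap k (Matrix ρ ρ k) c else 0 := by
  ext r s
  by_cases h : i = j <;> simp [blockAt, Matrix.algebraMap_matrix_apply, h]

variable {d : ℕ} (C₀ : Matrix (Fin d) (Fin d) k)

theorem blockAt_Mblock (n : ℕ) (i j : Fin n) :
    blockAt (Mblock C₀ n) i j =
      if i = j then C₀ else if (j : ℕ) = i + 1 then 1 else 0 := by
  ext r s
  simp only [blockAt, Mblock, Matrix.submatrix_apply, Matrix.of_apply]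
  split_ifs <;> simp_all [Matrix.one_apply]

theorem blockAt_aeval_Mblock (n : ℕ) (p : k[X]) :
    (∀ i j : Fin n, j < i → blockAt (aeval (Mblock C₀ n) p) i j = 0) ∧
    (∀ i : Fin n, blockAt (aeval (Mblock C₀ n) p) i i = aeval C₀ p) ∧
    ∀ i j : Fin n, (j : ℕ) = i + 1 →
      blockAt (aeval (Mblock C₀ n) p) i j = aeval C₀ (derivative p) := by
  induction p using polynomial_induction_mul_X with
  | C c =>
    simp only [aeval_C, blockAt_algebraMap, derivative_C, map_zero]
    refine ⟨fun i j h => if_neg h.ne', fun i => by simp, fun i j h => if_neg ?_⟩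
    rintro rfl
    omega
  | add p q hp hq =>
    refine ⟨fun i j h => ?_, fun i => ?_, fun i j h => ?_⟩
    · simp [hp.1 i j h, hq.1 i j h]
    · simp [hp.2.1 i, hq.2.1 i]
    · simp [hp.2.2 i j h, hq.2.2 i j h]
  | mul_X p hp =>
    obtain ⟨h₁, h₂, h₃⟩ := hp
    simp only [map_mul, aeval_X, blockAt_mul, derivative_mul, derivative_X, mul_one, map_add]
    refine ⟨fun i j h => ?_, fun i => ?_, fun i j h => ?_⟩
    · refine Finset.sum_eq_zero fun l _ => ?_
      rcases lt_or_ge l i with hl | hl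
      · rw [h₁ i l hl, Matrix.zero_mul]
      · rw [blockAt_Mblock, if_neg (by omega), if_neg (by omega), Matrix.mul_zero]
    · rw [Finset.sum_eq_single i _ (by simp), h₂, blockAt_Mblock, if_pos rfl]
      intro l _ hl
      rcases lt_or_gt_of_ne hl with hl | hl
      · rw [h₁ i l hl, Matrix.zero_mul]
      · rw [blockAt_Mblock, if_neg (by omega), if_neg (by omega), Matrix.mul_zero]
    · have hij : i ≠ j := by omega
      rw [← Finset.sum_subset (Finset.subset_univ {i, j}), Finset.sum_pair hij, h₂, h₃ i j h,
        blockAt_Mblock, blockAt_Mblock, if_neg hij, if_pos h, if_pos rfl, Matrix.mul_one,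
        add_comm]
      intro l _ hl
      simp only [Finset.mem_insert, Finset.mem_singleton, not_or] at hl
      rw [blockAt_Mblock, if_neg hl.2]
      rw [if_neg (by have := hl.1; omega), Matrix.mul_zero]

variable {C₀} {φ : k[X]}

theorem blockAt_aeval_Mblock_pow (h : aeval C₀ φ = 0) (n m : ℕ) (i j : Fin n) :
    ((j : ℕ) < i + m → blockAt (aeval (Mblock C₀ n) (φ ^ m)) i j = 0) ∧
    ((j : ℕ) = i + m →
      blockAt (aeval (Mblock C₀ n) (φ ^ m)) i j = aeval C₀ (derivative φ ^ m)) := by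
  obtain ⟨h₁, h₂, h₃⟩ := blockAt_aeval_Mblock C₀ n φ
  have hlow : ∀ l j : Fin n, j ≤ l → blockAt (aeval (Mblock C₀ n) φ) l j = 0 := by
    intro l j hlj
    rcases hlj.lt_or_eq with hlt | rfl
    · exact h₁ l j hlt
    · rw [h₂, h]
  induction m generalizing j with
  | zero =>
    have h₀ := blockAt_aeval_Mblock C₀ n 1
    refine ⟨fun hj => ?_, fun hj => ?_⟩
    · rw [pow_zero]; exact h₀.1 i j (by omega)
    · obtain rfl : j = i := by omega
      rw [pow_zero, pow_zero]; exact h₀.2.1 _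
  | succ m ih =>
    simp only [pow_succ, map_mul, blockAt_mul]
    refine ⟨fun hj => Finset.sum_eq_zero fun l _ => ?_, fun hj => ?_⟩
    · rcases lt_or_ge (l : ℕ) (i + m) with hl | hl
      · rw [(ih l).1 hl, Matrix.zero_mul]
      · rw [hlow l j (by omega), Matrix.mul_zero]
    · have hlt : (i : ℕ) + m < n := by omega
      rw [Finset.sum_eq_single ⟨i + m, hlt⟩ _ (by simp), (ih ⟨i + m, hlt⟩).2 rfl,
        h₃ ⟨i + m, hlt⟩ j (by simp only; omega)]
      intro l _ hl
      have hl' : (l : ℕ) ≠ i + m := fun e => hl (Fin.ext e)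
      rcases lt_or_gt_of_ne hl' with hl | hl
      · rw [(ih l).1 hl, Matrix.zero_mul]
      · rw [hlow l j (by omega), Matrix.mul_zero]

theorem aeval_Mblock_pow_eq_zero (h : aeval C₀ φ = 0) {n m : ℕ} (hnm : n ≤ m) :
    aeval (Mblock C₀ n) (φ ^ m) = 0 :=
  blockAt_ext fun i j => (blockAt_aeval_Mblock_pow h n m i j).1 (by omega)

theorem aeval_Mblock_pow_ne_zero (h : aeval C₀ φ = 0) {n : ℕ}
    (hn : aeval C₀ (derivative φ ^ n) ≠ 0) : aeval (Mblock C₀ (n + 1)) (φ ^ n) ≠ 0 := by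
  intro h0
  apply hn
  rw [← (blockAt_aeval_Mblock_pow h (n + 1) n 0 (Fin.last n)).2 (by simp), h0, blockAt_zero]

theorem blockAt_divDiff (a b : ℕ) (p : k[X])
    (Y : Matrix (Fin (a + 1) × Fin d) (Fin (b + 1) × Fin d) k) :
    blockAt (divDiff (Mblock C₀ (a + 1)) (Mblock C₀ (b + 1)) p Y) (Fin.last a) 0 =
      divDiff C₀ C₀ p (blockAt Y (Fin.last a) 0) := by
  induction p using polynomial_induction_mul_X with
  | C c => simp
  | add p q hp hq => simp only [divDiff_add, blockAt_add, hp, hq]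
  | mul_X p hp =>
    obtain ⟨h₁, h₂, -⟩ := blockAt_aeval_Mblock C₀ (a + 1) p
    obtain ⟨h₁', h₂', -⟩ := blockAt_aeval_Mblock C₀ (b + 1) X
    simp only [divDiff_mul, divDiff_X, blockAt_add, blockAt_mul]
    congr 1
    · rw [Finset.sum_eq_single (Fin.last a) _ (by simp), h₂]
      intro l _ hl
      rw [h₁ _ l (Fin.lt_last_iff_ne_last.2 hl), Matrix.zero_mul]
    · rw [Finset.sum_eq_single 0 _ (by simp), h₂', hp]
      intro l _ hl
      rw [h₁' l 0 (Fin.pos_iff_ne_zero.2 hl), Matrix.mul_zero]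

theorem divDiff_Mblock_pow_eq_zero_iff (h : aeval C₀ φ = 0)
    (hu : IsUnit (aeval C₀ (derivative φ))) (a b : ℕ)
    (Y : Matrix (Fin (a + 1) × Fin d) (Fin (b + 1) × Fin d) k) :
    divDiff (Mblock C₀ (a + 1)) (Mblock C₀ (b + 1)) (φ ^ (a + b + 1)) Y = 0 ↔
      divDiff C₀ C₀ φ (blockAt Y (Fin.last a) 0) = 0 := by
  set P := Mblock C₀ (a + 1)
  set Q := Mblock C₀ (b + 1)
  have hfactor : divDiff P Q (φ ^ (a + b + 1)) Y =
      aeval P (φ ^ a) * (divDiff P Q φ Y * aeval Q (φ ^ b)) := by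
    have hP : aeval P (φ ^ a) * aeval P φ = 0 := by
      rw [← map_mul, ← pow_succ]; exact aeval_Mblock_pow_eq_zero h le_rfl
    have hQ : aeval Q φ * aeval Q (φ ^ b) = 0 := by
      rw [← map_mul, ← pow_succ']; exact aeval_Mblock_pow_eq_zero h le_rfl
    rw [show φ ^ (a + b + 1) = φ ^ a * (φ * φ ^ b) by ring, divDiff_mul, divDiff_mul,
      map_mul, hQ, Matrix.mul_zero, add_zero, Matrix.mul_add, ← Matrix.mul_assoc, hP,
      Matrix.zero_mul, zero_add]
  have hP : ∀ i l : Fin (a + 1), l ≠ Fin.last a → blockAt (aeval P (φ ^ a)) i l = 0 :=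
    fun i l hl => (blockAt_aeval_Mblock_pow h (a + 1) a i l).1 (by
      have := Fin.lt_last_iff_ne_last.2 hl
      rw [Fin.lt_def, Fin.val_last] at this
      omega)
  have hQ : ∀ m j : Fin (b + 1), m ≠ 0 → blockAt (aeval Q (φ ^ b)) m j = 0 :=
    fun m j hm => (blockAt_aeval_Mblock_pow h (b + 1) b m j).1 (by
      have := Fin.pos_iff_ne_zero.2 hm
      rw [Fin.lt_def, Fin.val_zero] at this
      omega)
  have hblock : ∀ i j, blockAt (divDiff P Q (φ ^ (a + b + 1)) Y) i j =
      blockAt (aeval P (φ ^ a)) i (Fin.last a) *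
        (divDiff C₀ C₀ φ (blockAt Y (Fin.last a) 0) * blockAt (aeval Q (φ ^ b)) 0 j) := by
    intro i j
    rw [hfactor, blockAt_mul, Finset.sum_eq_single (Fin.last a) _ (by simp), blockAt_mul,
      Finset.sum_eq_single 0 _ (by simp), blockAt_divDiff]
    · intro m _ hm
      rw [hQ m j hm, Matrix.mul_zero]
    · intro l _ hl
      rw [hP i l hl, Matrix.zero_mul]
  constructor
  · intro h0
    have hcorner := hblock 0 (Fin.last b)
    rw [h0, blockAt_zero, (blockAt_aeval_Mblock_pow h (a + 1) a 0 _).2 (by simp),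
      (blockAt_aeval_Mblock_pow h (b + 1) b 0 _).2 (by simp), map_pow, map_pow] at hcorner
    exact (hu.pow b).mul_left_eq_zero.1 ((hu.pow a).mul_right_eq_zero.1 hcorner.symm)
  · intro h0
    exact blockAt_ext fun i j => by
      rw [hblock, h0, Matrix.zero_mul, Matrix.mul_zero, blockAt_zero]

end Block

section Counting

theorem natCard_ne_zero_of_surjective {V W : Type*} [Fintype k] [AddCommGroup V] [Module k V]
    [Finite V] [AddCommGroup W] [Module k W] (f : V →ₗ[k] W) (hf : Function.Surjective f) :
    (Nat.card {x // f x ≠ 0} : ℚ) = (Fintype.card k : ℚ) ^ Module.finrank k V *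
      (1 - (Fintype.card k : ℚ)⁻¹ ^ Module.finrank k W) := by
  have hrank := LinearMap.finrank_range_add_finrank_ker f
  rw [LinearMap.range_eq_top.2 hf, finrank_top] at hrank
  have hV := Module.natCard_eq_pow_finrank (K := k) (V := V)
  have hker := Module.natCard_eq_pow_finrank (K := k) (V := LinearMap.ker f)
  have hsum : Nat.card {x // f x = 0} + Nat.card {x // f x ≠ 0} = Nat.card V := by
    rw [← Nat.card_sum]
    exact Nat.card_congr (Equiv.sumCompl fun x => f x = 0)
  have hker' : Nat.card {x // f x = 0} = Nat.card (LinearMap.ker f) := rfl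
  rw [hker', hker, hV, ← hrank, Nat.card_eq_fintype_card] at hsum
  have hq : (Fintype.card k : ℚ) ≠ 0 := by simp
  rw [← hrank, mul_sub, mul_one, inv_pow, pow_add, mul_right_comm, mul_inv_cancel₀ (pow_ne_zero _ hq),
    one_mul, ← pow_add, eq_sub_iff_add_eq, add_comm]
  exact_mod_cast hsum

end Counting

section Similarity

open Polynomial

variable {φ : k[X]} {d : ℕ} {C₀ : Matrix (Fin d) (Fin d) k}

theorem matSimilar_fromBlocks_Mblock_iff (hφ : Irreducible φ) (hdeg : φ.natDegree = d)
    (h : aeval C₀ φ = 0) (hu : IsUnit (aeval C₀ (derivative φ))) {a b e : ℕ}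
    (he : a + b = e + 1) (Y : Matrix (Fin a × Fin d) (Fin b × Fin d) k) :
    MatSimilar (Matrix.fromBlocks (Mblock C₀ a) Y 0 (Mblock C₀ b)) (Mblock C₀ (a + b)) ↔
      aeval (Matrix.fromBlocks (Mblock C₀ a) Y 0 (Mblock C₀ b)) (φ ^ e) ≠ 0 := by
  have hB : aeval (Mblock C₀ (a + b)) (φ ^ e) ≠ 0 := by
    rw [he]
    refine aeval_Mblock_pow_ne_zero h ?_
    have : Nonempty (Fin d) := ⟨⟨0, hdeg ▸ hφ.natDegree_pos⟩⟩
    rw [map_pow]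
    exact (hu.pow e).ne_zero
  refine ⟨fun hsim hA => hB (hsim.aeval_eq_zero hA), fun hA => ?_⟩
  refine matSimilar_of_aeval_pow hφ ?_ ?_ ?_ hA (aeval_Mblock_pow_eq_zero h he.le) hB
  · simp [← he, hdeg, add_mul]
  · simp [he, hdeg]
  · rw [aeval_fromBlocks, ← he, aeval_Mblock_pow_eq_zero h (Nat.le_add_right a b),
      aeval_Mblock_pow_eq_zero h (Nat.le_add_left b a), pow_add, divDiff_mul,
      aeval_Mblock_pow_eq_zero h le_rfl, aeval_Mblock_pow_eq_zero h le_rfl, Matrix.zero_mul,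
      Matrix.mul_zero, add_zero, Matrix.fromBlocks_zero]

theorem matSimilar_fromBlocks_Mblock_of_eq_zero (hφ : Irreducible φ) (hdeg : φ.natDegree = d)
    (h : aeval C₀ φ = 0) (hu : IsUnit (aeval C₀ (derivative φ))) {a b : ℕ}
    (hab : a = 0 ∨ b = 0) (Y : Matrix (Fin a × Fin d) (Fin b × Fin d) k) :
    MatSimilar (Matrix.fromBlocks (Mblock C₀ a) Y 0 (Mblock C₀ b)) (Mblock C₀ (a + b)) := by
  have : Nonempty (Fin d) := ⟨⟨0, hdeg ▸ hφ.natDegree_pos⟩⟩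
  have hne : ∀ e, aeval (Mblock C₀ (e + 1)) (φ ^ e) ≠ 0 := fun e =>
    aeval_Mblock_pow_ne_zero h (by rw [map_pow]; exact (hu.pow e).ne_zero)
  rcases hab with rfl | rfl
  · rcases b with _ | b
    · have : IsEmpty (Fin (0 + 0)) := Fin.isEmpty'
      exact matSimilar_of_isEmpty _ _
    · rw [matSimilar_fromBlocks_Mblock_iff hφ hdeg h hu (Nat.zero_add _), aeval_fromBlocks]
      intro h0
      exact hne b (congrArg Matrix.toBlocks₂₂ h0)
  · rcases a with _ | a
    · have : IsEmpty (Fin (0 + 0)) := Fin.isEmpty'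
      exact matSimilar_of_isEmpty _ _
    · rw [matSimilar_fromBlocks_Mblock_iff hφ hdeg h hu (Nat.add_zero _), aeval_fromBlocks]
      intro h0
      exact hne a (congrArg Matrix.toBlocks₁₁ h0)

theorem matSimilar_fromBlocks_Mblock_succ_iff (hφ : Irreducible φ) (hdeg : φ.natDegree = d)
    (h : aeval C₀ φ = 0) (hu : IsUnit (aeval C₀ (derivative φ))) (a b : ℕ)
    (Y : Matrix (Fin (a + 1) × Fin d) (Fin (b + 1) × Fin d) k) :
    MatSimilar (Matrix.fromBlocks (Mblock C₀ (a + 1)) Y 0 (Mblock C₀ (b + 1)))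
        (Mblock C₀ (a + 1 + (b + 1))) ↔
      divDiff C₀ C₀ φ (blockAt Y (Fin.last a) 0) ≠ 0 := by
  rw [matSimilar_fromBlocks_Mblock_iff hφ hdeg h hu
      (show a + 1 + (b + 1) = a + b + 1 + 1 by ring), aeval_fromBlocks,
    aeval_Mblock_pow_eq_zero h (by omega), aeval_Mblock_pow_eq_zero h (by omega), not_iff_not,
    ← divDiff_Mblock_pow_eq_zero_iff h hu, ← Matrix.fromBlocks_zero, Matrix.fromBlocks_inj]
  simp

theorem isUnit_aeval_derivative (hφ : φ.Separable) (h : aeval C₀ φ = 0) :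
    IsUnit (aeval C₀ (derivative φ)) := by
  obtain ⟨r, s, hrs⟩ := hφ
  have := congrArg (aeval C₀) hrs
  rw [map_add, map_mul, map_mul, h, mul_zero, zero_add, map_one] at this
  exact IsUnit.of_mul_eq_one_right _ this

/-- The linear map sending `Y` to the first column of `divDiff C C φ` of its lower left block,
where `C` is the companion matrix of `φ`. -/
def cornerMap (φ : k[X]) (d a b : ℕ) :
    Matrix (Fin (a + 1) × Fin d) (Fin (b + 1) × Fin d) k →ₗ[k] (Fin d → k) where
  toFun Y := (divDiffLinear (companionMat d φ) (companionMat d φ) φ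
    (blockAt Y (Fin.last a) 0)).mulVec (firstVec d)
  map_add' Y Z := by rw [blockAt_add, map_add, Matrix.add_mulVec]
  map_smul' c Y := by
    rw [show blockAt (c • Y) (Fin.last a) 0 = c • blockAt Y (Fin.last a) 0 from rfl, map_smul,
      Matrix.smul_mulVec, RingHom.id_apply]

theorem cornerMap_eq_zero_iff {a b : ℕ} (h : aeval (companionMat d φ) φ = 0)
    (Y : Matrix (Fin (a + 1) × Fin d) (Fin (b + 1) × Fin d) k) :
    cornerMap φ d a b Y = 0 ↔
      divDiff (companionMat d φ) (companionMat d φ) φ (blockAt Y (Fin.last a) 0) = 0 := by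
  refine ⟨fun h0 => eq_zero_of_commute_companionMat (φ := φ) ?_ h0, fun h0 => ?_⟩
  · have := mul_divDiff_add (companionMat d φ) (companionMat d φ) φ (blockAt Y (Fin.last a) 0)
    rwa [h, Matrix.mul_zero, Matrix.zero_mul, add_zero, zero_add] at this
  · change (divDiff (companionMat d φ) (companionMat d φ) φ
      (blockAt Y (Fin.last a) 0)).mulVec (firstVec d) = 0
    rw [h0, Matrix.zero_mulVec]

theorem cornerMap_surjective (hφ : φ.Separable) (h : aeval (companionMat d φ) φ = 0) (a b : ℕ) :
    Function.Surjective (cornerMap φ d a b) := by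
  intro w
  obtain ⟨p, rfl⟩ := orbitMap_companionMat_surjective (φ := φ) d w
  obtain ⟨r, s, hrs⟩ := hφ
  set C₁ := companionMat d φ
  refine ⟨Matrix.of fun i j => aeval C₁ (s * p) i.2 j.2, ?_⟩
  change (divDiff C₁ C₁ φ (aeval C₁ (s * p))).mulVec (firstVec d) =
    (aeval C₁ p).mulVec (firstVec d)
  have hcomm : Commute C₁ (aeval C₁ (s * p)) := by
    have := (Commute.all X (s * p)).map (aeval C₁)
    rwa [aeval_X] at this
  have hmul : derivative φ * (s * p) + φ * (r * p) = p := by linear_combination p * hrs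
  have haeval := congrArg (aeval C₁) hmul
  rw [map_add, map_mul, map_mul _ φ, h, zero_mul, add_zero] at haeval
  rw [divDiff_self_of_commute _ _ hcomm, haeval]

end Similarity

/-- For a monic irreducible polynomial `π` of degree `d` over `F_q`
and `a, b ≥ 0`, the number of `da × db` matrices `M̄` such that the block matrix
`[[M_π(a), M̄], [0, M_π(b)]]` is similar to `M_π(a+b)` equals `q^{d²ab}(1 − q^{−d})`
when `a, b ≥ 1`, and equals `1` when `a = 0` or `b = 0`. -/
theorem count_upper_block_similar_to_full (F : Type) [Field F] [Fintype F]
    (a b : ℕ) (π : Polynomial F) (hmonic : π.Monic) (hirr : Irreducible π) :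
    (Nat.card {Mb : Matrix (Fin a × Fin π.natDegree) (Fin b × Fin π.natDegree) F //
        MatSimilar
          (Matrix.fromBlocks (Mblock (companionMat π.natDegree π) a) Mb 0
            (Mblock (companionMat π.natDegree π) b))
          (Mblock (companionMat π.natDegree π) (a + b))} : ℚ) =
      if a = 0 ∨ b = 0 then 1
      else (Fintype.card F : ℚ) ^ (π.natDegree ^ 2 * a * b) *
        (1 - ((Fintype.card F : ℚ))⁻¹ ^ π.natDegree) := by
  have hd : 0 < π.natDegree := hirr.natDegree_pos
  have hsep : π.Separable := PerfectField.separable_of_irreducible hirr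
  have h := aeval_companionMat hmonic rfl hd
  have hu := isUnit_aeval_derivative hsep h
  split_ifs with hab
  · have hsub : Subsingleton
        (Matrix (Fin a × Fin π.natDegree) (Fin b × Fin π.natDegree) F) := by
      rcases hab with rfl | rfl <;> infer_instance
    rw [Nat.cast_eq_one, Nat.card_eq_one_iff_unique]
    exact ⟨inferInstance,
      ⟨⟨0, matSimilar_fromBlocks_Mblock_of_eq_zero hirr rfl h hu hab 0⟩⟩⟩
  · push Not at hab
    obtain ⟨a, rfl⟩ := Nat.exists_eq_succ_of_ne_zero hab.1
    obtain ⟨b, rfl⟩ := Nat.exists_eq_succ_of_ne_zero hab.2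
    rw [Nat.card_congr (Equiv.subtypeEquivRight fun Y =>
        (matSimilar_fromBlocks_Mblock_succ_iff hirr rfl h hu a b Y).trans
          (not_congr (cornerMap_eq_zero_iff h Y)).symm),
      natCard_ne_zero_of_surjective _ (cornerMap_surjective hsep h a b), Module.finrank_matrix]
    simp only [Module.finrank_self, Module.finrank_fintype_fun_eq_card, Fintype.card_prod,
      Fintype.card_fin, mul_one]
    congr 2
    simp only [Nat.succ_eq_add_one]
    ring
end
end
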